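/- Let 𝔍 be the random monomial ideal of the ER-type model with parameter p ∈ (0,1). Then the probability that the quotient ring S/𝔍 has Krull dimension 1 equals Σ_{j=0}^{n−1} C(n,j) · (1 − (1−p)^D)^j · (1−p)^{D(n−j)} · (1 − (1−p)^{C(D,2)})^{C(n−j,2)}, where C(a,b) denotes the binomial coefficient 'a choose b'. -/

import Mathlib

open Finset MvPolynomial Filter

noncomputable section

/-- The set of exponent vectors of nonconstant monomials in `n` variables of total degree
at most `D`. -/
def monSet (n D : ℕ) : Finset (Fin n → ℕ) :=
  (Fintype.piFinset fun _ : Fin n => Finset.range (D + 1)).filter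
    fun α => 0 < ∑ i, α i ∧ ∑ i, α i ≤ D

/-- The monomial `x^α` of `MvPolynomial (Fin n) K` with exponent vector `α`. -/
def mono (K : Type*) [CommRing K] {n : ℕ} (α : Fin n → ℕ) : MvPolynomial (Fin n) K :=
  MvPolynomial.monomial (Finsupp.equivFunOnFinite.symm α) 1

/-- The monomial ideal generated by a set of exponent vectors. -/
def idealOf (K : Type*) [CommRing K] {n : ℕ} (B : Finset (Fin n → ℕ)) :
    Ideal (MvPolynomial (Fin n) K) :=
  Ideal.span (mono K '' (B : Set (Fin n → ℕ)))

open Classical in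
/-- The probability, under the ER-type model `ℐ(n,D,p)`, of the event `E` on random
generating sets `𝔅 ⊆ M(n,D)`. -/
def ERprob (n D : ℕ) (p : ℝ) (E : Set (Finset (Fin n → ℕ))) : ℝ :=
  ∑ B ∈ (monSet n D).powerset.filter (· ∈ E),
    p ^ B.card * (1 - p) ^ ((monSet n D).card - B.card)

/-- `I` is a monomial ideal. -/
def IsMonomialIdeal (K : Type*) [CommRing K] {n : ℕ}
    (I : Ideal (MvPolynomial (Fin n) K)) : Prop :=
  ∃ G : Set (Fin n → ℕ), I = Ideal.span (mono K '' G)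

/-- `x^α` is a minimal monomial generator of `I`: it lies in `I` and no proper divisor does. -/
def IsMinGen (K : Type*) [CommRing K] {n : ℕ} (I : Ideal (MvPolynomial (Fin n) K))
    (α : Fin n → ℕ) : Prop :=
  mono K α ∈ I ∧ ∀ β : Fin n → ℕ, (∀ i, β i ≤ α i) → β ≠ α → mono K β ∉ I

/-- `β₁(S/I)`: the number of minimal monomial generators of `I`. -/
def beta1 (K : Type*) [CommRing K] {n : ℕ} (I : Ideal (MvPolynomial (Fin n) K)) : ℕ :=
  {α : Fin n → ℕ | IsMinGen K I α}.ncard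

/-- `β_{1,d}(S/I)`: the number of minimal monomial generators of `I` of degree `d`. -/
def beta1d (K : Type*) [CommRing K] {n : ℕ} (I : Ideal (MvPolynomial (Fin n) K)) (d : ℕ) : ℕ :=
  {α : Fin n → ℕ | IsMinGen K I α ∧ ∑ i, α i = d}.ncard

/-- `h_I(d)`: the number of monomials of degree exactly `d` not contained in `I`. -/
def hilb (K : Type*) [CommRing K] {n : ℕ} (I : Ideal (MvPolynomial (Fin n) K)) (d : ℕ) : ℕ :=
  {α : Fin n → ℕ | ∑ i, α i = d ∧ mono K α ∉ I}.ncard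

section Algebra

variable {K : Type*} [Field K] {n : ℕ}

/-- The set of indices of the variables dividing `x^α`. -/
def monSupport (α : Fin n → ℕ) : Finset (Fin n) := univ.filter fun i => α i ≠ 0

lemma mem_monSupport {α : Fin n → ℕ} {i : Fin n} : i ∈ monSupport α ↔ α i ≠ 0 := by
  simp [monSupport]

lemma mono_eq_prod (α : Fin n → ℕ) : mono K α = ∏ i, (X i : MvPolynomial (Fin n) K) ^ α i := by
  rw [mono, monomial_eq, C_1, one_mul, Finsupp.prod_fintype _ _ (by simp)]
  rfl

/-- A set of variables containing no generator spans a coordinate subspace of the zero locus. -/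
lemma card_le_ringKrullDim_quotient_idealOf {B : Finset (Fin n → ℕ)} {W : Finset (Fin n)}
    (hW : ∀ α ∈ B, ¬ monSupport α ⊆ W) :
    ((#W : ℕ) : WithBot ℕ∞) ≤ ringKrullDim (MvPolynomial (Fin n) K ⧸ idealOf K B) := by
  let f : MvPolynomial (Fin n) K →ₐ[K] MvPolynomial W K :=
    aeval fun i => if h : i ∈ W then X ⟨i, h⟩ else 0
  have hf : Function.Surjective f := by
    rw [← AlgHom.range_eq_top, eq_top_iff, ← adjoin_range_X, Algebra.adjoin_le_iff]
    rintro _ ⟨i, rfl⟩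
    exact ⟨X i, by simp [f]⟩
  have hker : idealOf K B ≤ RingHom.ker f.toRingHom := by
    rw [idealOf, Ideal.span_le]
    rintro _ ⟨α, hα, rfl⟩
    obtain ⟨i, hi, hiW⟩ := not_subset.mp (hW α hα)
    change f (mono K α) = 0
    rw [mono_eq_prod, map_prod]
    refine prod_eq_zero (mem_univ i) ?_
    simp [f, hiW, mem_monSupport.mp hi]
  calc ((#W : ℕ) : WithBot ℕ∞) = ringKrullDim (MvPolynomial W K) := by
        simp [MvPolynomial.ringKrullDim_of_isNoetherianRing, ringKrullDim_eq_zero_of_field]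
    _ ≤ _ := ringKrullDim_le_of_surjective (Ideal.Quotient.lift _ f.toRingHom hker)
        (Ideal.Quotient.lift_surjective_of_surjective _ _ hf)

/-- Killing all variables outside `W` leaves a ring of dimension at most `#W`. -/
lemma ringKrullDim_quotient_span_X_compl_le (W : Finset (Fin n)) :
    ringKrullDim (MvPolynomial (Fin n) K ⧸
      Ideal.span ((X : Fin n → MvPolynomial (Fin n) K) '' {i | i ∉ W})) ≤ (#W : ℕ) := by
  set J := Ideal.span ((X : Fin n → MvPolynomial (Fin n) K) '' {i | i ∉ W})
  let f : MvPolynomial W K →ₐ[K] MvPolynomial (Fin n) K ⧸ J :=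
    aeval fun i => Ideal.Quotient.mkₐ K J (X i)
  have hf : Function.Surjective f := by
    suffices h : (Ideal.Quotient.mkₐ K J).range ≤ f.range by
      rw [← AlgHom.range_eq_top, eq_top_iff]
      rwa [(AlgHom.range_eq_top _).mpr (Ideal.Quotient.mkₐ_surjective K J)] at h
    rw [← Algebra.map_top, ← adjoin_range_X, AlgHom.map_adjoin, Algebra.adjoin_le_iff]
    rintro _ ⟨_, ⟨i, rfl⟩, rfl⟩
    by_cases hi : i ∈ W
    · exact ⟨X ⟨i, hi⟩, by simp [f]⟩
    · refine ⟨0, ?_⟩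
      have : (X i : MvPolynomial (Fin n) K) ∈ J := Ideal.subset_span ⟨i, hi, rfl⟩
      simpa [eq_comm] using Ideal.Quotient.eq_zero_iff_mem.mpr this
  refine (ringKrullDim_le_of_surjective f.toRingHom hf).trans ?_
  simp [MvPolynomial.ringKrullDim_of_isNoetherianRing, ringKrullDim_eq_zero_of_field]

/-- The dimension of the quotient by a monomial ideal is the largest size of a set of variables
in which no generator is supported. -/
lemma ringKrullDim_quotient_idealOf_le_iff (B : Finset (Fin n → ℕ)) (d : ℕ) :
    ringKrullDim (MvPolynomial (Fin n) K ⧸ idealOf K B) ≤ (d : WithBot ℕ∞) ↔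
      ∀ W : Finset (Fin n), (∀ α ∈ B, ¬ monSupport α ⊆ W) → #W ≤ d := by
  classical
  refine ⟨fun h W hW => ?_, fun h => ?_⟩
  · exact_mod_cast (card_le_ringKrullDim_quotient_idealOf (K := K) hW).trans h
  rw [ringKrullDim_quotient, Order.krullDim]
  refine iSup_le fun l => ?_
  let P := l.head.1.asIdeal
  have hP : P.IsPrime := l.head.1.isPrime
  let W : Finset (Fin n) := univ.filter fun i => (X i : MvPolynomial (Fin n) K) ∉ P
  have hW : #W ≤ d := by
    refine h W fun α hα hαW => ?_
    have hmem : mono K α ∈ P := l.head.2 (Ideal.subset_span ⟨α, hα, rfl⟩)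
    rw [mono_eq_prod, hP.prod_mem_iff] at hmem
    obtain ⟨i, -, hi⟩ := hmem
    have h0 : α i ≠ 0 := fun h0 => hP.ne_top ((Ideal.eq_top_iff_one _).mpr (by simpa [h0] using hi))
    exact (mem_filter.mp (hαW (mem_monSupport.mpr h0))).2 (hP.mem_of_pow_mem _ hi)
  let J := Ideal.span ((X : Fin n → MvPolynomial (Fin n) K) '' {i | i ∉ W})
  have hJ : ∀ k, J ≤ (l k).1.asIdeal := by
    intro k
    rw [Ideal.span_le]
    rintro _ ⟨i, hi, rfl⟩
    have hle : P ≤ (l k).1.asIdeal := LTSeries.head_le l k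
    exact hle (by simpa [W] using hi)
  let l' : LTSeries (PrimeSpectrum.zeroLocus (R := MvPolynomial (Fin n) K) J) :=
    ⟨l.length, fun k => ⟨(l k).1, hJ k⟩, fun k => l.step k⟩
  calc (l.length : WithBot ℕ∞) ≤ Order.krullDim
        (PrimeSpectrum.zeroLocus (R := MvPolynomial (Fin n) K) J) :=
        le_iSup (fun l : LTSeries _ => (l.length : WithBot ℕ∞)) l'
    _ = ringKrullDim (MvPolynomial (Fin n) K ⧸ J) := (ringKrullDim_quotient J).symm
    _ ≤ (#W : ℕ) := ringKrullDim_quotient_span_X_compl_le W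
    _ ≤ d := by exact_mod_cast hW

lemma ringKrullDim_quotient_idealOf_eq_one_iff (B : Finset (Fin n → ℕ)) :
    ringKrullDim (MvPolynomial (Fin n) K ⧸ idealOf K B) = (1 : WithBot (WithTop ℕ)) ↔
      (∃ i, ∀ α ∈ B, ¬ monSupport α ⊆ {i}) ∧
        ∀ W : Finset (Fin n), #W = 2 → ∃ α ∈ B, monSupport α ⊆ W := by
  have h1 := ringKrullDim_quotient_idealOf_le_iff (K := K) B 1
  constructor
  · intro h
    refine ⟨?_, fun W hW => ?_⟩
    · by_contra! hno
      have h0 := (ringKrullDim_quotient_idealOf_le_iff (K := K) B 0).mpr fun W hW => by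
        rw [Nat.le_zero, card_eq_zero, eq_empty_iff_forall_notMem]
        intro i hi
        obtain ⟨α, hα, hαi⟩ := hno i
        exact hW α hα (hαi.trans (singleton_subset_iff.mpr hi))
      have h10 : ((1 : ℕ) : WithBot ℕ∞) ≤ (0 : ℕ) := h.ge.trans h0
      exact Nat.not_succ_le_zero 0 (by exact_mod_cast h10)
    · by_contra! hno
      have := h1.mp h.le W hno
      omega
  · rintro ⟨⟨i, hi⟩, hpair⟩
    refine le_antisymm (h1.mpr fun W hW => ?_) ?_
    · by_contra! hcard
      obtain ⟨V, hVW, hV⟩ := exists_subset_card_eq hcard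
      obtain ⟨α, hα, hαV⟩ := hpair V hV
      exact hW α hα (hαV.trans hVW)
    · have h := card_le_ringKrullDim_quotient_idealOf (K := K) hi
      rw [card_singleton, Nat.cast_one] at h
      exact h

end Algebra

section Probability

variable {β ι : Type*}

/-- The weight of `B` as a random subset of `M` whose elements are kept independently with
probability `p`. -/
def bernoulliWeight (p : ℝ) (M B : Finset β) : ℝ := p ^ #B * (1 - p) ^ (#M - #B)

lemma sum_bernoulliWeight (p : ℝ) (M : Finset β) :
    ∑ B ∈ M.powerset, bernoulliWeight p M B = 1 := by
  simp [bernoulliWeight, Finset.sum_pow_mul_eq_add_pow]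

variable [DecidableEq β]

/-- The traces of a random subset on `A` and on its complement are independent. -/
lemma sum_bernoulliWeight_inter_mul_sdiff (p : ℝ) {M A : Finset β} (hA : A ⊆ M)
    (f g : Finset β → ℝ) :
    ∑ B ∈ M.powerset, bernoulliWeight p M B * (f (B ∩ A) * g (B \ A)) =
      (∑ B ∈ A.powerset, bernoulliWeight p A B * f B) *
        ∑ B ∈ (M \ A).powerset, bernoulliWeight p (M \ A) B * g B := by
  rw [sum_mul_sum, ← sum_product']
  refine sum_nbij' (fun B => (B ∩ A, B \ A)) (fun x => x.1 ∪ x.2) ?_ ?_ ?_ ?_ ?_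
  · intro B hB
    simp only [mem_product, mem_powerset] at hB ⊢
    exact ⟨inter_subset_right, sdiff_subset_sdiff hB subset_rfl⟩
  · rintro ⟨B, C⟩ h
    simp only [mem_product, mem_powerset] at h ⊢
    exact union_subset (h.1.trans hA) (h.2.trans sdiff_subset)
  · intro B _
    exact (union_comm _ _).trans (sdiff_union_inter B A)
  · rintro ⟨B, C⟩ h
    simp only [mem_product, mem_powerset] at h
    ext x
    · have := @h.1 x; have := @h.2 x; grind
    · have := @h.1 x; have := @h.2 x; grind
  · intro B hB
    rw [mem_powerset] at hB
    have h1 : #(B ∩ A) + #(B \ A) = #B := card_inter_add_card_sdiff B A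
    have h2 : #(M ∩ A) + #(M \ A) = #M := card_inter_add_card_sdiff M A
    rw [inter_eq_right.mpr hA] at h2
    have h3 : #(B ∩ A) ≤ #A := card_le_card inter_subset_right
    have h4 : #(B \ A) ≤ #(M \ A) := card_le_card (sdiff_subset_sdiff hB subset_rfl)
    have h5 : #M - #B = (#A - #(B ∩ A)) + (#(M \ A) - #(B \ A)) := by omega
    simp only [bernoulliWeight]
    rw [h5, ← h1, pow_add, pow_add]
    ring

/-- The traces of a random subset on pairwise disjoint sets are independent. -/
lemma sum_bernoulliWeight_prod_inter (p : ℝ) (s : Finset ι) (A : ι → Finset β)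
    (hdisj : (s : Set ι).PairwiseDisjoint A) (f : ι → Finset β → ℝ) {M : Finset β}
    (hM : ∀ c ∈ s, A c ⊆ M) :
    ∑ B ∈ M.powerset, bernoulliWeight p M B * ∏ c ∈ s, f c (B ∩ A c) =
      ∏ c ∈ s, ∑ B ∈ (A c).powerset, bernoulliWeight p (A c) B * f c B := by
  classical
  induction s using Finset.induction_on generalizing M with
  | empty => simp [sum_bernoulliWeight]
  | insert c s hc ih =>
    have hd : ∀ c' ∈ s, Disjoint (A c') (A c) := fun c' hc' =>
      hdisj (by simp [hc']) (by simp) (by rintro rfl; exact hc hc')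
    rw [prod_insert hc, ← ih (M := M \ A c) (hdisj.subset (by simp))
      (fun c' hc' => subset_sdiff.mpr ⟨hM c' (by simp [hc']), hd c' hc'⟩),
      ← sum_bernoulliWeight_inter_mul_sdiff p (hM c (by simp)) (f c)]
    refine sum_congr rfl fun B _ => ?_
    rw [prod_insert hc]
    congr 2
    refine prod_congr rfl fun c' hc' => ?_
    have := disjoint_left.mp (hd c' hc')
    congr 1
    ext x
    grind

/-- Prescribing which of a family of disjoint sets a random subset misses. -/
lemma sum_bernoulliWeight_inter_eq_empty_iff [DecidableEq ι] (p : ℝ) (s T : Finset ι)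
    (A : ι → Finset β) (hdisj : (s : Set ι).PairwiseDisjoint A) {M : Finset β}
    (hM : ∀ c ∈ s, A c ⊆ M) {P : Finset β → Prop} [DecidablePred P]
    (hP : ∀ B, P B ↔ ∀ c ∈ s, (B ∩ A c = ∅ ↔ c ∈ T)) :
    ∑ B ∈ M.powerset with P B, bernoulliWeight p M B =
      ∏ c ∈ s, if c ∈ T then (1 - p) ^ #(A c) else 1 - (1 - p) ^ #(A c) := by
  have key : ∀ C : Finset β, ∑ B ∈ C.powerset, bernoulliWeight p C B * (if B = ∅ then 1 else 0) =
      (1 - p) ^ #C := by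
    intro C
    simp [bernoulliWeight]
  have h := sum_bernoulliWeight_prod_inter p s A hdisj
    (fun c B => if (B = ∅ ↔ c ∈ T) then 1 else 0) hM
  simp only [prod_boole, mul_boole, ← hP] at h
  rw [sum_filter, h]
  refine prod_congr rfl fun c _ => ?_
  split_ifs with hc
  · simp [← key, hc]
  · rw [← key, eq_sub_iff_add_eq, ← sum_add_distrib]
    refine (sum_congr rfl fun B _ => ?_).trans (sum_bernoulliWeight p (A c))
    by_cases hB : B = ∅ <;> simp [hB, hc]

end Probability

section Counting

variable {n D : ℕ}

lemma mem_monSet {α : Fin n → ℕ} : α ∈ monSet n D ↔ 0 < ∑ i, α i ∧ ∑ i, α i ≤ D := by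
  simp only [monSet, mem_filter, Fintype.mem_piFinset, mem_range, and_iff_right_iff_imp]
  exact fun h i => Nat.lt_succ_of_le
    ((single_le_sum (fun j _ => Nat.zero_le (α j)) (mem_univ i)).trans h.2)

lemma monSupport_nonempty {α : Fin n → ℕ} (h : α ∈ monSet n D) : (monSupport α).Nonempty := by
  obtain ⟨i, -, hi⟩ := exists_ne_zero_of_sum_ne_zero (mem_monSet.mp h).1.ne'
  exact ⟨i, mem_monSupport.mpr hi⟩

/-- The monomials of `monSet n D` divisible by exactly the variables in `c`. -/
def monSetWithSupport (n D : ℕ) (c : Finset (Fin n)) : Finset (Fin n → ℕ) :=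
  (monSet n D).filter fun α => monSupport α = c

lemma monSetWithSupport_subset (c : Finset (Fin n)) : monSetWithSupport n D c ⊆ monSet n D :=
  filter_subset _ _

lemma pairwiseDisjoint_monSetWithSupport (s : Set (Finset (Fin n))) :
    s.PairwiseDisjoint (monSetWithSupport n D) := by
  intro c _ c' _ hne
  refine disjoint_left.mpr fun α h h' => hne ?_
  rw [← (mem_filter.mp h).2, (mem_filter.mp h').2]

lemma mem_monSetWithSupport {c : Finset (Fin n)} (hc : c.Nonempty) {α : Fin n → ℕ} :
    α ∈ monSetWithSupport n D c ↔
      ∑ i ∈ c, α i ≤ D ∧ (∀ i ∈ c, α i ≠ 0) ∧ ∀ i ∉ c, α i = 0 := by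
  have hsupp : monSupport α = c ↔ (∀ i ∈ c, α i ≠ 0) ∧ ∀ i ∉ c, α i = 0 := by
    simp only [Finset.ext_iff, mem_monSupport]
    grind
  rw [monSetWithSupport, mem_filter, mem_monSet, hsupp]
  refine and_congr_left fun ⟨h1, h0⟩ => ?_
  rw [← sum_subset (subset_univ c) fun i _ hi => h0 i hi, and_iff_right_iff_imp]
  exact fun _ => sum_pos (fun i hi => Nat.pos_of_ne_zero (h1 i hi)) hc

lemma card_monSetWithSupport_singleton (i : Fin n) : #(monSetWithSupport n D {i}) = D := by
  conv_rhs => rw [← card_range D]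
  refine card_nbij' (fun α => α i - 1) (fun a => Pi.single i (a + 1)) ?_ ?_ ?_ ?_
  · intro α hα
    have h := (mem_monSetWithSupport (singleton_nonempty i)).mp hα
    simp only [sum_singleton, mem_singleton, forall_eq] at h
    simp only [coe_range, Set.mem_Iio]
    omega
  · intro a ha
    refine (mem_monSetWithSupport (singleton_nonempty i)).mpr ?_
    simp only [coe_range, Set.mem_Iio] at ha
    simp +contextual [ha]
  · intro α hα
    have h := (mem_monSetWithSupport (singleton_nonempty i)).mp hα
    simp only [sum_singleton, mem_singleton, forall_eq] at h
    ext j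
    by_cases hj : j = i
    · subst hj
      simp only [Pi.single_eq_same]
      omega
    · simp [hj, h.2.2 j hj]
  · intro a _
    simp

lemma card_monSetWithSupport_pair {i k : Fin n} (hik : i ≠ k) :
    #(monSetWithSupport n D {i, k}) = D.choose 2 := by
  have hcard : #((range D).sigma fun s => range s) = D.choose 2 := by
    simp [card_sigma, sum_range_id, Nat.choose_two_right]
  have hne : ({i, k} : Finset (Fin n)).Nonempty := ⟨i, by simp⟩
  rw [← hcard]
  refine card_nbij' (fun α => ⟨α i + α k - 1, α i - 1⟩)
    (fun x => Pi.single i (x.2 + 1) + Pi.single k (x.1 - x.2)) ?_ ?_ ?_ ?_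
  · intro α hα
    have h := (mem_monSetWithSupport hne).mp hα
    simp only [sum_pair hik, mem_insert, mem_singleton, forall_eq_or_imp, forall_eq] at h
    simp only [coe_sigma, Set.mem_sigma_iff, coe_range, Set.mem_Iio]
    omega
  · intro x hx
    simp only [coe_sigma, Set.mem_sigma_iff, coe_range, Set.mem_Iio] at hx
    refine (mem_monSetWithSupport hne).mpr ?_
    simp only [sum_pair hik, mem_insert, mem_singleton, forall_eq_or_imp, forall_eq, Pi.add_apply,
      Pi.single_eq_same, Pi.single_eq_of_ne hik, Pi.single_eq_of_ne hik.symm, not_or]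
    refine ⟨by omega, by omega, fun j hj => by simp [hj]⟩
  · intro α hα
    have h := (mem_monSetWithSupport hne).mp hα
    simp only [sum_pair hik, mem_insert, mem_singleton, forall_eq_or_imp, forall_eq, not_or] at h
    ext j
    by_cases hi : j = i
    · subst hi
      simp only [Pi.add_apply, Pi.single_eq_same, Pi.single_eq_of_ne hik]
      omega
    · by_cases hk : j = k
      · subst hk
        simp only [Pi.add_apply, Pi.single_eq_same, Pi.single_eq_of_ne hi]
        omega
      · simp [hi, hk, h.2.2 j ⟨hi, hk⟩]
  · rintro ⟨s, t⟩ hx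
    simp only [coe_sigma, Set.mem_sigma_iff, coe_range, Set.mem_Iio] at hx
    simp only [Pi.add_apply, Pi.single_eq_same, Pi.single_eq_of_ne hik,
      Pi.single_eq_of_ne hik.symm]
    rw [Sigma.mk.injEq, heq_eq_eq]
    omega

end Counting

section PurePowers

variable {n D : ℕ}

/-- The indices of the variables having a pure power in `B`. -/
def purePowerVars (D : ℕ) (B : Finset (Fin n → ℕ)) : Finset (Fin n) :=
  univ.filter fun i => B ∩ monSetWithSupport n D {i} ≠ ∅

lemma mem_purePowerVars {B : Finset (Fin n → ℕ)} {i : Fin n} :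
    i ∈ purePowerVars D B ↔ B ∩ monSetWithSupport n D {i} ≠ ∅ := by
  simp [purePowerVars]

lemma inter_monSetWithSupport_eq_empty_iff {B : Finset (Fin n → ℕ)} (hB : B ⊆ monSet n D)
    (c : Finset (Fin n)) : B ∩ monSetWithSupport n D c = ∅ ↔ ∀ α ∈ B, monSupport α ≠ c := by
  simp only [eq_empty_iff_forall_notMem, mem_inter, monSetWithSupport, mem_filter, not_and]
  exact ⟨fun h α hα => h α hα (hB hα), fun h α hα _ => h α hα⟩

lemma ringKrullDim_quotient_idealOf_eq_one_iff_purePowerVars (K : Type*) [Field K]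
    {B : Finset (Fin n → ℕ)} (hB : B ⊆ monSet n D) :
    ringKrullDim (MvPolynomial (Fin n) K ⧸ idealOf K B) = (1 : WithBot (WithTop ℕ)) ↔
      #(purePowerVars D B) < n ∧
        ∀ c ∈ powersetCard 2 (purePowerVars D B)ᶜ, B ∩ monSetWithSupport n D c ≠ ∅ := by
  have hsub : ∀ i, ∀ α ∈ B, (monSupport α ⊆ {i} ↔ monSupport α = {i}) := fun i α hα =>
    (monSupport_nonempty (hB hα)).subset_singleton_iff
  have hvars : ∀ i, i ∉ purePowerVars D B ↔ ∀ α ∈ B, monSupport α ≠ {i} := fun i => by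
    rw [mem_purePowerVars, not_not, inter_monSetWithSupport_eq_empty_iff hB]
  rw [ringKrullDim_quotient_idealOf_eq_one_iff]
  refine and_congr ?_ ?_
  · have hlt : #(purePowerVars D B) < n ↔ purePowerVars D B ≠ univ := by
      simpa using card_lt_iff_ne_univ (purePowerVars D B)
    rw [hlt, ne_eq, eq_univ_iff_forall, not_forall]
    refine exists_congr fun i => ?_
    rw [hvars]
    exact forall₂_congr fun α hα => not_congr (hsub i α hα)
  · simp only [mem_powersetCard, and_imp, ne_eq, inter_monSetWithSupport_eq_empty_iff hB,
      not_forall, not_not, exists_prop]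
    constructor
    · intro h c hc hc2
      obtain ⟨α, hα, hαc⟩ := h c hc2
      refine ⟨α, hα, hαc.antisymm fun i hi => ?_⟩
      by_contra hiα
      have hlt : #(monSupport α) < 2 := hc2 ▸ card_lt_card ⟨hαc, fun h => hiα (h hi)⟩
      have hone : #(monSupport α) = 1 := by
        have := (monSupport_nonempty (hB hα)).card_pos
        omega
      obtain ⟨j, hj⟩ := card_eq_one.mp hone
      exact (hvars j).mp (mem_compl.mp (hc (hαc (by simp [hj])))) α hα hj
    · intro h W hW
      by_cases hWc : W ⊆ (purePowerVars D B)ᶜ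
      · obtain ⟨α, hα, rfl⟩ := h W hWc hW
        exact ⟨α, hα, subset_rfl⟩
      · obtain ⟨i, hi, hiB⟩ := not_subset.mp hWc
        have := (hvars i).not.mp (by simpa using hiB)
        push Not at this
        obtain ⟨α, hα, hαi⟩ := this
        exact ⟨α, hα, by simpa [hαi] using hi⟩

/-- The event that the variables with a pure power are exactly those in `U`, and that every pair
of the others is the support of a generator. -/
lemma forall_inter_monSetWithSupport_eq_empty_iff (B : Finset (Fin n → ℕ)) (U : Finset (Fin n)) :
    (∀ c ∈ powersetCard 1 univ ∪ powersetCard 2 Uᶜ,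
      (B ∩ monSetWithSupport n D c = ∅ ↔ c ∈ powersetCard 1 Uᶜ)) ↔
      purePowerVars D B = U ∧ ∀ c ∈ powersetCard 2 Uᶜ, B ∩ monSetWithSupport n D c ≠ ∅ := by
  rw [forall_mem_union]
  refine and_congr ?_ (forall₂_congr fun c hc => ?_)
  · simp only [powersetCard_one, Finset.mem_map, mem_univ, true_and, Function.Embedding.coeFn_mk,
      forall_exists_index, forall_apply_eq_imp_iff, singleton_inj, exists_eq_right, mem_compl,
      Finset.ext_iff (s₁ := purePowerVars D B), mem_purePowerVars]
    exact forall_congr' fun i => by tauto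
  · have : c ∉ powersetCard 1 Uᶜ := fun h => by
      have h1 := (mem_powersetCard.mp h).2
      have h2 := (mem_powersetCard.mp hc).2
      omega
    simp [this]

lemma sum_bernoulliWeight_purePowerVars (p : ℝ) (U : Finset (Fin n)) :
    ∑ B ∈ (monSet n D).powerset with purePowerVars D B = U ∧
        ∀ c ∈ powersetCard 2 Uᶜ, B ∩ monSetWithSupport n D c ≠ ∅,
      bernoulliWeight p (monSet n D) B =
      (1 - (1 - p) ^ D) ^ #U * (1 - p) ^ (D * (n - #U)) *
        (1 - (1 - p) ^ D.choose 2) ^ (n - #U).choose 2 := by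
  have hdisj : Disjoint (powersetCard 1 univ) (powersetCard 2 Uᶜ) :=
    disjoint_left.mpr fun c h1 h2 => by
      rw [mem_powersetCard] at h1 h2
      omega
  have hpair : ∀ c ∈ powersetCard 2 Uᶜ, (if c ∈ powersetCard 1 Uᶜ then
      (1 - p) ^ #(monSetWithSupport n D c) else 1 - (1 - p) ^ #(monSetWithSupport n D c)) =
      1 - (1 - p) ^ D.choose 2 := by
    intro c hc
    obtain ⟨-, hc2⟩ := mem_powersetCard.mp hc
    obtain ⟨i, k, hik, rfl⟩ := card_eq_two.mp hc2
    rw [if_neg (by simp [mem_powersetCard, hc2]), card_monSetWithSupport_pair hik]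
  rw [sum_bernoulliWeight_inter_eq_empty_iff p _ _ _ (pairwiseDisjoint_monSetWithSupport _)
    (fun c _ => monSetWithSupport_subset c)
    (fun B => (forall_inter_monSetWithSupport_eq_empty_iff B U).symm),
    prod_union hdisj, prod_congr rfl hpair, prod_const,
    card_powersetCard, card_compl, Fintype.card_fin]
  congr 1
  rw [powersetCard_one, prod_map]
  simp only [powersetCard_one, Function.Embedding.coeFn_mk, Finset.mem_map, singleton_inj,
    exists_eq_right, mem_compl, card_monSetWithSupport_singleton]
  have hcompl : (univ.filter fun i => i ∉ U) = Uᶜ := by ext; simp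
  rw [prod_ite, prod_const, prod_const, mul_comm, pow_mul, hcompl, card_compl, Fintype.card_fin]
  simp

end PurePowers

/-- Theorem 3.2(b). Under the ER-type model, `P(dim S/𝔍 = 1)` equals
`Σ_{j=0}^{n-1} C(n,j) (1-(1-p)^D)^j (1-p)^{D(n-j)} (1-(1-p)^{C(D,2)})^{C(n-j,2)}`. -/
theorem stmt5 (K : Type*) [Field K] (n D : ℕ) (hn : 1 ≤ n) (hD : 1 ≤ D)
    (p : ℝ) (hp0 : 0 < p) (hp1 : p < 1) :
    ERprob n D p {B | ringKrullDim (MvPolynomial (Fin n) K ⧸ idealOf K B)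
        = (1 : WithBot (WithTop ℕ))} =
      ∑ j ∈ Finset.range n, (n.choose j : ℝ) * (1 - (1 - p) ^ D) ^ j
        * (1 - p) ^ (D * (n - j)) * (1 - (1 - p) ^ D.choose 2) ^ (n - j).choose 2 := by
  classical
  have h : ERprob n D p {B | ringKrullDim (MvPolynomial (Fin n) K ⧸ idealOf K B)
      = (1 : WithBot (WithTop ℕ))} =
      ∑ B ∈ (monSet n D).powerset with #(purePowerVars D B) < n ∧
        ∀ c ∈ powersetCard 2 (purePowerVars D B)ᶜ, B ∩ monSetWithSupport n D c ≠ ∅,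
        bernoulliWeight p (monSet n D) B := by
    refine sum_congr (filter_congr fun B hB => ?_) fun _ _ => rfl
    exact ringKrullDim_quotient_idealOf_eq_one_iff_purePowerVars K (mem_powerset.mp hB)
  rw [h, ← sum_fiberwise_of_maps_to (g := purePowerVars D)
    (t := univ.filter fun U : Finset (Fin n) => #U < n)
    (fun B hB => by simpa using (mem_filter.mp hB).2.1)]
  calc _ = ∑ U : Finset (Fin n) with #U < n, (1 - (1 - p) ^ D) ^ #U * (1 - p) ^ (D * (n - #U)) *
        (1 - (1 - p) ^ D.choose 2) ^ (n - #U).choose 2 := by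
        refine sum_congr rfl fun U hU => ?_
        rw [← sum_bernoulliWeight_purePowerVars p U, filter_filter]
        refine sum_congr (filter_congr fun B _ => ?_) fun _ _ => rfl
        constructor
        · rintro ⟨⟨-, hc⟩, rfl⟩
          exact ⟨rfl, hc⟩
        · rintro ⟨rfl, hc⟩
          exact ⟨⟨(mem_filter.mp hU).2, hc⟩, rfl⟩
    _ = _ := by
        rw [sum_filter, ← powerset_univ, sum_powerset_apply_card (fun j => if j < n then
          (1 - (1 - p) ^ D) ^ j * (1 - p) ^ (D * (n - j)) *
            (1 - (1 - p) ^ D.choose 2) ^ (n - j).choose 2 else 0), card_univ, Fintype.card_fin,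
          sum_range_succ, if_neg (lt_irrefl n), smul_zero, add_zero]
        refine sum_congr rfl fun j hj => ?_
        rw [if_pos (mem_range.mp hj), nsmul_eq_mul]
        ring

end
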